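/- arXiv:1804.09422 — 5 statements merged into one kernel-verified Lean document; each statement's English description precedes it below -/
import Mathlib

section
/- Let G be a finite simple graph and l ≥ 0 an integer, and suppose G has the property that any two independent sets of G of size exactly l+1 are TAR_l-reachable from each other (as holds for even-hole-free graphs by a result of Kamiński, Medvedev, and Milanič). Let I_ini be an independent set of G with |I_ini| ≥ l such that either |I_ini| > l, or I_ini is not a maximal independent set of G. Then for every maximum independent set I_max of G, it holds that I_ini ↝_l I_max. -/
def IsIndepSet {V : Type*} (G : SimpleGraph V) (I : Finset V) : Prop :=
  ∀ u ∈ I, ∀ v ∈ I, ¬ G.Adj u v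

def TarStep {V : Type*} [DecidableEq V] (G : SimpleGraph V) (l : ℕ) (A B : Finset V) : Prop :=
  IsIndepSet G A ∧ IsIndepSet G B ∧ l ≤ A.card ∧ l ≤ B.card ∧ (symmDiff A B).card = 1

def TarReach {V : Type*} [DecidableEq V] (G : SimpleGraph V) (l : ℕ) :
    Finset V → Finset V → Prop :=
  Relation.ReflTransGen (TarStep G l)

theorem IsIndepSet.subset {V : Type*} {G : SimpleGraph V} {A B : Finset V}
    (hB : IsIndepSet G B) (hAB : A ⊆ B) : IsIndepSet G A :=
  fun u hu v hv => hB u (hAB hu) v (hAB hv)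

theorem TarStep.symm {V : Type*} [DecidableEq V] {G : SimpleGraph V} {l : ℕ} {A B : Finset V}
    (h : TarStep G l A B) : TarStep G l B A := by
  obtain ⟨hA, hB, hlA, hlB, hAB⟩ := h
  exact ⟨hB, hA, hlB, hlA, by rwa [symmDiff_comm]⟩

theorem TarReach.symm {V : Type*} [DecidableEq V] {G : SimpleGraph V} {l : ℕ} {A B : Finset V}
    (h : TarReach G l A B) : TarReach G l B A := by
  induction h with
  | refl => exact Relation.ReflTransGen.refl
  | tail _ hstep ih => exact Relation.ReflTransGen.head hstep.symm ih

/-- An independent set is reachable from each of its subsets of size at least `l`, by adding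
the missing vertices one at a time. -/
theorem TarReach.of_subset {V : Type*} [DecidableEq V] {G : SimpleGraph V} {l : ℕ}
    {A B : Finset V} (hB : IsIndepSet G B) (hAB : A ⊆ B) (hl : l ≤ A.card) :
    TarReach G l A B := by
  induction B using Finset.strongInduction with
  | H B ih =>
    obtain rfl | hne := eq_or_ne A B
    · exact Relation.ReflTransGen.refl
    obtain ⟨x, hxB, hxA⟩ := Finset.exists_of_ssubset (hAB.ssubset_of_ne hne)
    have hA : A ⊆ B.erase x := Finset.subset_erase.2 ⟨hAB, hxA⟩
    have hE : IsIndepSet G (B.erase x) := hB.subset (Finset.erase_subset x B)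
    refine (ih _ (Finset.erase_ssubset hxB) hE hA).tail
      ⟨hE, hB, hl.trans (Finset.card_le_card hA), hl.trans (Finset.card_le_card hAB), ?_⟩
    rw [symmDiff_of_le (Finset.erase_subset x B), Finset.card_sdiff_of_subset
      (Finset.erase_subset x B), Finset.card_erase_of_mem hxB]
    have := Finset.card_pos.2 ⟨x, hxB⟩
    omega

/-- An independent set of size at least `l` that is larger than `l` or not maximal reaches an
independent set of size exactly `l + 1`. -/
theorem exists_tarReach_card_eq_succ {V : Type*} [DecidableEq V] {G : SimpleGraph V} {l : ℕ}
    {I : Finset V} (hI : IsIndepSet G I) (hl : l ≤ I.card)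
    (h : l < I.card ∨ ∃ J : Finset V, I ⊂ J ∧ IsIndepSet G J) :
    ∃ A : Finset V, IsIndepSet G A ∧ A.card = l + 1 ∧ TarReach G l I A := by
  by_cases hlt : l < I.card
  · obtain ⟨A, hAI, hA⟩ := Finset.exists_subset_card_eq (Nat.succ_le_of_lt hlt)
    exact ⟨A, hI.subset hAI, hA, (TarReach.of_subset hI hAI (by omega)).symm⟩
  · obtain ⟨J, hIJ, hJ⟩ := h.resolve_left hlt
    have := Finset.card_lt_card hIJ
    obtain ⟨A, hIA, hAJ, hA⟩ := Finset.exists_subsuperset_card_eq (n := l + 1) hIJ.subset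
      (by omega) (by omega)
    exact ⟨A, hJ.subset hAJ, hA, TarReach.of_subset (hJ.subset hAJ) hIA hl⟩

/-- if any two independent sets of size exactly `l+1` are TAR_l-reachable
from each other, and `I_ini` is an independent set of size at least `l` which has size
greater than `l` or is not maximal, then `I_ini` can reach every maximum independent set. -/
theorem tarReach_maximum_of_connected_level {V : Type*} [Fintype V] [DecidableEq V]
    (G : SimpleGraph V) (l : ℕ)
    (hconn : ∀ A B : Finset V, IsIndepSet G A → IsIndepSet G B →
      A.card = l + 1 → B.card = l + 1 → TarReach G l A B)
    (Iini : Finset V) (hini : IsIndepSet G Iini) (hl : l ≤ Iini.card)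
    (hcase : l < Iini.card ∨ ∃ J : Finset V, Iini ⊂ J ∧ IsIndepSet G J)
    (Imax : Finset V) (hmaxI : IsIndepSet G Imax)
    (hmax : ∀ J : Finset V, IsIndepSet G J → J.card ≤ Imax.card) :
    TarReach G l Iini Imax := by
  obtain ⟨A, hA, hAcard, hreach⟩ := exists_tarReach_card_eq_succ hini hl hcase
  obtain ⟨B, hBI, hB⟩ := Finset.exists_subset_card_eq (hAcard ▸ hmax A hA)
  have hBind := hmaxI.subset hBI
  exact (hreach.trans (hconn A B hA hBind hAcard hB)).trans
    (TarReach.of_subset hmaxI hBI (by omega))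
end

section
/- Let G be a finite simple graph, l ≥ 0 and s ≥ 0 integers, and let I_ini be an independent set of G with |I_ini| ≥ l. Suppose b_i and b_j are two distinct vertices of G with identical closed neighborhoods, N_G[b_i] = N_G[b_j], and with b_i ∉ I_ini and b_j ∉ I_ini. Then G has an independent set I with |I| ≥ s and I_ini ↝_l I (in G) if and only if the induced subgraph G − b_i (obtained by deleting b_i) has an independent set I' with |I'| ≥ s and I_ini ↝_l I' (in G − b_i). -/
/-- One TAR_l step in the induced subgraph \`G - b\`: a TAR_l step of \`G\` in which
both independent sets avoid the deleted vertex \`b\`. -/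
def TarStepDel {V : Type*} [DecidableEq V] (G : SimpleGraph V) (l : ℕ) (b : V)
    (A B : Finset V) : Prop :=
  b ∉ A ∧ b ∉ B ∧ TarStep G l A B

/-- TAR_l reachability in the induced subgraph \`G - b\` (whose independent sets are
exactly the independent sets of \`G\` avoiding \`b\`, with the same adjacency). -/
def TarReachDel {V : Type*} [DecidableEq V] (G : SimpleGraph V) (l : ℕ) (b : V) :
    Finset V → Finset V → Prop :=
  Relation.ReflTransGen (TarStepDel G l b)

theorem IsIndepSet.image {V W : Type*} [DecidableEq W] {G : SimpleGraph V} {H : SimpleGraph W}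
    {f : V → W} (hf : ∀ u v, H.Adj (f u) (f v) → G.Adj u v) {A : Finset V}
    (hA : IsIndepSet G A) : IsIndepSet H (A.image f) := by
  intro u hu v hv huv
  obtain ⟨a, ha, rfl⟩ := Finset.mem_image.1 hu
  obtain ⟨b, hb, rfl⟩ := Finset.mem_image.1 hv
  exact hA a ha b hb (hf a b huv)

theorem card_symmDiff_eq_one_iff {V : Type*} [DecidableEq V] {A B : Finset V} :
    (symmDiff A B).card = 1 ↔
      (A ⊆ B ∧ B.card = A.card + 1) ∨ (B ⊆ A ∧ A.card = B.card + 1) := by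
  have hcard : (symmDiff A B).card = (A \ B).card + (B \ A).card :=
    Finset.card_union_of_disjoint disjoint_sdiff_sdiff
  have hA := Finset.card_sdiff_add_card_inter A B
  have hB := Finset.card_sdiff_add_card_inter B A
  rw [Finset.inter_comm] at hB
  rw [← Finset.sdiff_eq_empty_iff_subset, ← Finset.sdiff_eq_empty_iff_subset,
    ← Finset.card_eq_zero, ← Finset.card_eq_zero]
  omega

/-- A map that reflects adjacency and is injective on independent sets preserves TAR steps. -/
theorem TarStep.image {V W : Type*} [DecidableEq V] [DecidableEq W] {G : SimpleGraph V}
    {H : SimpleGraph W} {f : V → W} (hf : ∀ u v, H.Adj (f u) (f v) → G.Adj u v)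
    (hinj : ∀ A : Finset V, IsIndepSet G A → Set.InjOn f A) {l : ℕ} {A B : Finset V}
    (h : TarStep G l A B) : TarStep H l (A.image f) (B.image f) := by
  obtain ⟨hA, hB, hlA, hlB, hAB⟩ := h
  have cA := Finset.card_image_of_injOn (hinj A hA)
  have cB := Finset.card_image_of_injOn (hinj B hB)
  refine ⟨hA.image hf, hB.image hf, cA ▸ hlA, cB ▸ hlB, ?_⟩
  rw [card_symmDiff_eq_one_iff, cA, cB]
  exact (card_symmDiff_eq_one_iff.1 hAB).imp
    (And.imp_left (Finset.image_subset_image ·)) (And.imp_left (Finset.image_subset_image ·))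

theorem TarReach.isIndepSet {V : Type*} [DecidableEq V] {G : SimpleGraph V} {l : ℕ}
    {A B : Finset V} (h : TarReach G l A B) (hA : IsIndepSet G A) : IsIndepSet G B := by
  cases h with
  | refl => exact hA
  | tail _ hstep => exact hstep.2.1

/-- if `bi` and `bj` are distinct twins (identical closed neighborhoods)
outside `I_ini`, then `G` has an independent set of size at least `s` reachable from
`I_ini` under TAR_l iff `G - bi` does. -/
theorem twin_removal {V : Type*} [Fintype V] [DecidableEq V]
    (G : SimpleGraph V) (l s : ℕ)
    (Iini : Finset V) (hini : IsIndepSet G Iini) (hIl : l ≤ Iini.card)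
    (bi bj : V) (hne : bi ≠ bj)
    (htwin : (insert bi (G.neighborSet bi) : Set V) = insert bj (G.neighborSet bj))
    (hbi : bi ∉ Iini) (hbj : bj ∉ Iini) :
    (∃ I : Finset V, TarReach G l Iini I ∧ s ≤ I.card) ↔
      (∃ I' : Finset V, TarReachDel G l bi Iini I' ∧ s ≤ I'.card) := by
  constructor
  · rintro ⟨I, hI, hs⟩
    have htw (v : V) : v = bi ∨ G.Adj bi v ↔ v = bj ∨ G.Adj bj v := by
      simpa using Set.ext_iff.1 htwin v
    have hadj : G.Adj bi bj := ((htw bj).2 (Or.inl rfl)).resolve_left hne.symm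
    let f : V → V := fun v => if v = bi then bj else v
    have hf_adj (u v : V) (huv : G.Adj (f u) (f v)) : G.Adj u v := by
      have hmove (w : V) (hw : w ≠ bi) (h : G.Adj bj w) : G.Adj bi w :=
        ((htw w).2 (Or.inr h)).resolve_left hw
      simp only [f] at huv
      split_ifs at huv with hu hv hv
      · exact (G.irrefl huv).elim
      · exact hu ▸ hmove v hv huv
      · exact hv ▸ (hmove u hu huv.symm).symm
      · exact huv
    have hf_inj (A : Finset V) (hA : IsIndepSet G A) : Set.InjOn f A := by
      intro u hu v hv huv
      simp only [f] at huv
      split_ifs at huv with hu' hv' hv'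
      · exact hu'.trans hv'.symm
      · subst hu' huv
        exact (hA _ hu _ hv hadj).elim
      · subst hv' huv
        exact (hA _ hv _ hu hadj).elim
      · exact huv
    have hf_notMem (A : Finset V) : bi ∉ A.image f := by
      intro h
      obtain ⟨v, -, hv⟩ := Finset.mem_image.1 h
      simp only [f] at hv
      split_ifs at hv with hv'
      · exact hne hv.symm
      · exact hv' hv
    have hf_ini : Iini.image f = Iini := by
      refine (Finset.image_congr fun v hv => ?_).trans Finset.image_id
      exact if_neg (ne_of_mem_of_not_mem hv hbi)
    refine ⟨I.image f, ?_, ?_⟩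
    · have h := Relation.ReflTransGen.lift (p := TarStepDel G l bi) (Finset.image f)
        (fun A B hAB => ⟨hf_notMem A, hf_notMem B, hAB.image hf_adj hf_inj⟩) _ _ hI
      rwa [Function.onFun, hf_ini] at h
    · rwa [Finset.card_image_of_injOn (hf_inj I (hI.isIndepSet hini))]
  · rintro ⟨I, hI, hs⟩
    exact ⟨I, Relation.ReflTransGen.mono (fun _ _ h => h.2.2) _ _ hI, hs⟩
end

section
/- Let d ≥ 0 and s ≥ 0 be integers and let G be a finite d-degenerate simple graph, i.e., every nonempty induced subgraph of G has a vertex of degree at most d within that subgraph. Let S ⊆ V(G) with |S| = 2s + d + 1, and let C be a set of vertices such that N_G[b] ∩ N_G[b'] = C for every pair of distinct vertices b, b' ∈ S. Then S ∩ C is a clique of G with |S ∩ C| ≤ d + 1, and hence |S \ C| ≥ 2s. -/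
/-- A clique in a graph all of whose nonempty vertex sets contain a vertex with at most `d`
neighbors inside has at most `d + 1` vertices. -/
theorem SimpleGraph.IsClique.card_le_of_degenerate {V : Type*} [DecidableEq V]
    {G : SimpleGraph V} [DecidableRel G.Adj] {d : ℕ}
    (hdeg : ∀ T : Finset V, T.Nonempty → ∃ v ∈ T, (T.filter (fun w => G.Adj v w)).card ≤ d)
    {T : Finset V} (hT : G.IsClique (T : Set V)) : T.card ≤ d + 1 := by
  rcases T.eq_empty_or_nonempty with rfl | hne
  · simp
  obtain ⟨v, hv, hd⟩ := hdeg T hne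
  have hsub : T.erase v ⊆ T.filter (fun w => G.Adj v w) := fun w hw => by
    obtain ⟨hwv, hwT⟩ := Finset.mem_erase.mp hw
    exact Finset.mem_filter.mpr ⟨hwT, hT hv hwT hwv.symm⟩
  have := Finset.card_le_card hsub
  have := Finset.card_erase_add_one hv
  omega

/-- in a `d`-degenerate graph, if the closed neighborhoods of the
`2s + d + 1` vertices of `S` form a sunflower with core `C`, then `S ∩ C` is a clique
of size at most `d + 1`, and hence `|S \ C| ≥ 2s`. -/
theorem sunflower_core_small {V : Type*} [Fintype V] [DecidableEq V]
    (G : SimpleGraph V) [DecidableRel G.Adj] (d s : ℕ)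
    (hdeg : ∀ T : Finset V, T.Nonempty → ∃ v ∈ T, (T.filter (fun w => G.Adj v w)).card ≤ d)
    (S C : Finset V) (hScard : S.card = 2 * s + d + 1)
    (hsun : ∀ b ∈ S, ∀ b' ∈ S, b ≠ b' →
      insert b (G.neighborFinset b) ∩ insert b' (G.neighborFinset b') = C) :
    G.IsClique ((S ∩ C : Finset V) : Set V) ∧ (S ∩ C).card ≤ d + 1 ∧
      2 * s ≤ (S \ C).card := by
  have hclique : G.IsClique ((S ∩ C : Finset V) : Set V) := by
    intro x hx y hy hxy
    rw [Finset.mem_coe, Finset.mem_inter] at hx hy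
    have hyC := hy.2
    rw [← hsun x hx.1 y hy.1 hxy, Finset.mem_inter, Finset.mem_insert,
      SimpleGraph.mem_neighborFinset] at hyC
    exact hyC.1.resolve_left hxy.symm
  have hcard := hclique.card_le_of_degenerate hdeg
  refine ⟨hclique, hcard, ?_⟩
  have := Finset.card_inter_add_card_sdiff S C
  omega
end

section
/- Let G be a finite simple graph, s ≥ 1 an integer, let S ⊆ V(G) and let C be a set of vertices such that N_G[b] ∩ N_G[b'] = C for every pair of distinct vertices b, b' ∈ S, and suppose |S \ C| ≥ 2s. Let b ∈ S, and let I be an independent set of G with |I| < s and I ∩ N_G[b] = ∅. Then I ∪ S', where S' = S \ ({b} ∪ C ∪ N_G[I]) and N_G[I] = ⋃_{v ∈ I} N_G[v], is an independent set of G of size at least s. -/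
/-- if the closed neighborhoods of the vertices of `S` form a sunflower
with core `C`, `|S \ C| ≥ 2s`, `b ∈ S`, and `I` is an independent set with `|I| < s`
disjoint from `N[b]`, then `I ∪ S'` with `S' = S \ ({b} ∪ C ∪ N[I])` is an independent
set of size at least `s`. -/
theorem sunflower_augment {V : Type*} [Fintype V] [DecidableEq V]
    (G : SimpleGraph V) [DecidableRel G.Adj] (s : ℕ) (hs : 1 ≤ s)
    (S C : Finset V)
    (hsun : ∀ b ∈ S, ∀ b' ∈ S, b ≠ b' →
      insert b (G.neighborFinset b) ∩ insert b' (G.neighborFinset b') = C)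
    (hSC : 2 * s ≤ (S \ C).card)
    (b : V) (hb : b ∈ S)
    (I : Finset V) (hI : IsIndepSet G I) (hIs : I.card < s)
    (hIb : I ∩ insert b (G.neighborFinset b) = ∅) :
    IsIndepSet G
        (I ∪ (S \ ({b} ∪ C ∪ I.biUnion fun v => insert v (G.neighborFinset v)))) ∧
      s ≤ (I ∪ (S \ ({b} ∪ C ∪ I.biUnion fun v => insert v (G.neighborFinset v)))).card := by
  have core_sub : ∀ u ∈ S, ∀ u' ∈ S, u ≠ u' →
      C ⊆ insert b (G.neighborFinset b) := by
    intro u hu u' hu' hne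
    by_cases hbu : b = u
    · rw [← hsun b hb u' hu' (hbu ▸ hne)]
      exact Finset.inter_subset_left
    · rw [← hsun b hb u hu hbu]
      exact Finset.inter_subset_left
  have mem_core : ∀ u ∈ S, ∀ u' ∈ S, u ≠ u' → ∀ w,
      (w = u ∨ G.Adj u w) → (w = u' ∨ G.Adj u' w) → w ∈ C := by
    intro u hu u' hu' hne w h h'
    rw [← hsun u hu u' hu' hne]
    simpa using ⟨h, h'⟩
  have at_most_one : ∀ v ∈ I,
      ((S \ C) ∩ insert v (G.neighborFinset v)).card ≤ 1 := by
    intro v hv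
    rw [Finset.card_le_one]
    intro u hu u' hu'
    by_contra hne
    simp only [Finset.mem_inter, Finset.mem_sdiff, Finset.mem_insert,
      SimpleGraph.mem_neighborFinset] at hu hu'
    have hvC : v ∈ C := mem_core u hu.1.1 u' hu'.1.1 hne v
      (hu.2.imp Eq.symm (·.symm)) (hu'.2.imp Eq.symm (·.symm))
    have : v ∈ I ∩ insert b (G.neighborFinset b) :=
      Finset.mem_inter.2 ⟨hv, core_sub u hu.1.1 u' hu'.1.1 hne hvC⟩
    simp [hIb] at this
  constructor
  · have cross : ∀ u ∈ I, ∀ v ∈ S \ ({b} ∪ C ∪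
        I.biUnion fun v => insert v (G.neighborFinset v)), ¬ G.Adj u v := by
      intro u hu v hv huv
      refine (Finset.mem_sdiff.1 hv).2 (Finset.mem_union_right _ ?_)
      exact Finset.mem_biUnion.2 ⟨u, hu, by simp [huv]⟩
    intro u hu v hv huv
    rcases Finset.mem_union.1 hu with hu | hu <;> rcases Finset.mem_union.1 hv with hv | hv
    · exact hI u hu v hv huv
    · exact cross u hu v hv huv
    · exact cross v hv u hu huv.symm
    · have hu' := Finset.mem_sdiff.1 hu
      have huC : u ∈ C := mem_core u hu'.1 v (Finset.mem_sdiff.1 hv).1 huv.ne u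
        (Or.inl rfl) (Or.inr huv.symm)
      exact hu'.2 (Finset.mem_union_left _ (Finset.mem_union_right _ huC))
  · set S' := S \ ({b} ∪ C ∪ I.biUnion fun v => insert v (G.neighborFinset v)) with hS'
    have cover : S \ C ⊆ S' ∪ ({b} ∪
        I.biUnion fun v => (S \ C) ∩ insert v (G.neighborFinset v)) := by
      intro u hu
      simp only [hS', Finset.mem_union, Finset.mem_sdiff, Finset.mem_biUnion,
        Finset.mem_inter, Finset.mem_singleton] at hu ⊢
      grind
    have h_cover := Finset.card_le_card cover
    have h_union := Finset.card_union_le S' ({b} ∪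
      I.biUnion fun v => (S \ C) ∩ insert v (G.neighborFinset v))
    have h_singleton := Finset.card_union_le {b}
      (I.biUnion fun v => (S \ C) ∩ insert v (G.neighborFinset v))
    have h_biUnion := Finset.card_biUnion_le_card_mul I
      (fun v => (S \ C) ∩ insert v (G.neighborFinset v)) 1 at_most_one
    have h_sub : S'.card ≤ (I ∪ S').card := Finset.card_le_card Finset.subset_union_right
    rw [Finset.card_singleton] at h_singleton
    omega
end

section
/- Let d ≥ 0, l ≥ 0, s ≥ 1 be integers with l < s, and let G be a finite d-degenerate simple graph, i.e., every nonempty induced subgraph of G has a vertex of degree at most d within that subgraph. Let I_ini be an independent set of G with l ≤ |I_ini| < s. Let S ⊆ V(G) \ I_ini with |S| = 2s + d + 1, and let C be a set of vertices such that N_G[b] ∩ N_G[b'] = C for every pair of distinct vertices b, b' ∈ S. Then for every vertex b ∈ S: G has an independent set I with |I| ≥ s and I_ini ↝_l I (in G) if and only if G − b has an independent set I' with |I'| ≥ s and I_ini ↝_l I' (in G − b). -/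
theorem TarReachDel.tarReach {V : Type*} [DecidableEq V] {G : SimpleGraph V} {l : ℕ} {b : V}
    {A B : Finset V} (h : TarReachDel G l b A B) : TarReach G l A B :=
  Relation.ReflTransGen.mono (fun _ _ hs => hs.2.2) _ _ h

/-- An independent set can be enlarged one vertex at a time to any independent superset
avoiding `b`. -/
theorem tarReachDel_union {V : Type*} [DecidableEq V] {G : SimpleGraph V} {l : ℕ} {b : V}
    {A T : Finset V} (hl : l ≤ A.card) (hI : IsIndepSet G (A ∪ T)) (hb : b ∉ A ∪ T) :
    TarReachDel G l b A (A ∪ T) := by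
  induction T using Finset.induction_on with
  | empty =>
    rw [Finset.union_empty]
    exact Relation.ReflTransGen.refl
  | insert x T hx ih =>
    have hsub : A ∪ T ⊆ A ∪ insert x T :=
      Finset.union_subset_union_right (Finset.subset_insert x T)
    have hIT : IsIndepSet G (A ∪ T) := fun u hu v hv => hI u (hsub hu) v (hsub hv)
    have hbT : b ∉ A ∪ T := fun h => hb (hsub h)
    have hreach := ih hIT hbT
    by_cases hxA : x ∈ A ∪ T
    · rwa [Finset.union_insert, Finset.insert_eq_of_mem hxA]
    · refine hreach.tail ⟨hbT, hb, hIT, hI, ?_, ?_, ?_⟩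
      · exact hl.trans (Finset.card_le_card Finset.subset_union_left)
      · exact hl.trans (Finset.card_le_card Finset.subset_union_left)
      · rw [Finset.card_eq_one]
        refine ⟨x, ?_⟩
        ext y
        simp only [Finset.mem_symmDiff, Finset.union_insert, Finset.mem_insert,
          Finset.mem_singleton]
        constructor
        · tauto
        · rintro rfl
          tauto

/-- A step that introduces `b` only adds vertices. -/
theorem TarStep.subset_of_notMem {V : Type*} [DecidableEq V] {G : SimpleGraph V} {l : ℕ} {b : V}
    {A B : Finset V} (h : TarStep G l A B) (hA : b ∉ A) (hB : b ∈ B) : A ⊆ B := by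
  intro a ha
  by_contra haB
  have hab : a = b := Finset.card_le_one.mp h.2.2.2.2.le a
    (Finset.mem_symmDiff.mpr (Or.inl ⟨ha, haB⟩)) b (Finset.mem_symmDiff.mpr (Or.inr ⟨hB, hA⟩))
  exact hA (hab ▸ ha)

/-- If two petal vertices of a sunflower of closed neighborhoods are adjacent, then all of them
form a clique; hence the petal vertices of a large sunflower in a degenerate graph are
independent. -/
theorem isIndepSet_of_sunflower {V : Type*} [Fintype V] [DecidableEq V]
    {G : SimpleGraph V} [DecidableRel G.Adj] {d : ℕ} {S C : Finset V}
    (hdeg : ∀ T : Finset V, T.Nonempty → ∃ v ∈ T, (T.filter (fun w => G.Adj v w)).card ≤ d)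
    (hcard : d + 1 < S.card)
    (hsun : ∀ b ∈ S, ∀ b' ∈ S, b ≠ b' →
      insert b (G.neighborFinset b) ∩ insert b' (G.neighborFinset b') = C) :
    IsIndepSet G S := by
  have mem_iff : ∀ x ∈ S, ∀ y ∈ S, x ≠ y → ∀ z,
      z ∈ C ↔ (z = x ∨ G.Adj x z) ∧ (z = y ∨ G.Adj y z) := by
    intro x hx y hy hxy z
    simp [← hsun x hx y hy hxy]
  intro u hu v hv huv
  have huC : u ∈ C := (mem_iff u hu v hv huv.ne u).mpr ⟨Or.inl rfl, Or.inr huv.symm⟩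
  have hadj : ∀ x ∈ S, x ≠ u → G.Adj x u := fun x hx hxu =>
    (((mem_iff x hx u hu hxu u).mp huC).1).resolve_left hxu.symm
  have hSC : ∀ x ∈ S, x ∈ C := by
    intro x hx
    by_cases hxu : x = u
    · exact hxu ▸ huC
    · exact (mem_iff x hx u hu hxu x).mpr ⟨Or.inl rfl, Or.inr (hadj x hx hxu).symm⟩
  obtain ⟨w, hw, hwd⟩ := hdeg S ⟨u, hu⟩
  have hfilter : S.erase w ⊆ S.filter (fun x => G.Adj w x) := by
    intro x hx
    obtain ⟨hxw, hxS⟩ := Finset.mem_erase.mp hx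
    exact Finset.mem_filter.mpr ⟨hxS,
      (((mem_iff w hw x hxS hxw.symm x).mp (hSC x hxS)).1).resolve_left hxw⟩
  have := Finset.card_le_card hfilter
  rw [Finset.card_erase_of_mem hw] at this
  omega

/-- If `A ∪ {b}` is independent for a petal vertex `b`, then all but at most `|A|` of the other
petal vertices have closed neighborhoods disjoint from `A`. -/
theorem card_free_petals {V : Type*} [Fintype V] [DecidableEq V]
    {G : SimpleGraph V} [DecidableRel G.Adj] {S C A : Finset V} {b : V} (hb : b ∈ S)
    (hbA : b ∉ A) (hA : ∀ a ∈ A, ¬ G.Adj b a)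
    (hsun : ∀ b ∈ S, ∀ b' ∈ S, b ≠ b' →
      insert b (G.neighborFinset b) ∩ insert b' (G.neighborFinset b') = C) :
    S.card ≤ ((S.erase b).filter (fun x => ∀ a ∈ A, ¬ (a = x ∨ G.Adj x a))).card +
      A.card + 1 := by
  have hbad : ((S.erase b).filter (fun x => ¬ ∀ a ∈ A, ¬ (a = x ∨ G.Adj x a))).card ≤ A.card := by
    refine Finset.card_le_card_of_forall_subsingleton (fun x a => a = x ∨ G.Adj x a) ?_ ?_
    · intro x hx
      have := (Finset.mem_filter.mp hx).2
      push Not at this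
      exact this
    · rintro a ha x ⟨hx, hxa⟩ y ⟨hy, hya⟩
      by_contra hxy
      obtain ⟨hxb, hxS⟩ := Finset.mem_erase.mp (Finset.mem_filter.mp hx).1
      have hyS := (Finset.mem_erase.mp (Finset.mem_filter.mp hy).1).2
      have haC : a ∈ C := by
        rw [← hsun x hxS y hyS hxy]
        simpa using ⟨hxa, hya⟩
      rw [← hsun b hb x hxS hxb.symm] at haC
      have hab : a = b ∨ G.Adj b a := by simpa using (Finset.mem_inter.mp haC).1
      exact hab.elim (fun h => hbA (h ▸ ha)) (hA a ha)
  have hsplit := Finset.card_filter_add_card_filter_not (s := S.erase b)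
    (fun x => ∀ a ∈ A, ¬ (a = x ∨ G.Adj x a))
  rw [Finset.card_erase_of_mem hb] at hsplit
  omega

/-- in a `d`-degenerate graph, given a sunflower of closed neighborhoods
of `2s + d + 1` vertices outside `I_ini` with core `C`, any petal vertex `b` can be
deleted without changing whether an independent set of size at least `s` is reachable
from `I_ini` under TAR_l. -/
theorem sunflower_removal {V : Type*} [Fintype V] [DecidableEq V]
    (G : SimpleGraph V) [DecidableRel G.Adj] (d l s : ℕ) (hls : l < s)
    (hdeg : ∀ T : Finset V, T.Nonempty → ∃ v ∈ T, (T.filter (fun w => G.Adj v w)).card ≤ d)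
    (Iini : Finset V) (hini : IsIndepSet G Iini)
    (hIl : l ≤ Iini.card) (hIs : Iini.card < s)
    (S C : Finset V) (hSI : ∀ v ∈ S, v ∉ Iini) (hScard : S.card = 2 * s + d + 1)
    (hsun : ∀ b ∈ S, ∀ b' ∈ S, b ≠ b' →
      insert b (G.neighborFinset b) ∩ insert b' (G.neighborFinset b') = C) :
    ∀ b ∈ S,
      ((∃ I : Finset V, TarReach G l Iini I ∧ s ≤ I.card) ↔
        (∃ I' : Finset V, TarReachDel G l b Iini I' ∧ s ≤ I'.card)) := by
  intro b hb
  refine ⟨?_, fun ⟨I, hI, hs⟩ => ⟨I, hI.tarReach, hs⟩⟩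
  rintro ⟨I, hI, hsI⟩
  have hSindep : IsIndepSet G S := isIndepSet_of_sunflower hdeg (by omega) hsun
  have hmain : (b ∉ I ∧ TarReachDel G l b Iini I) ∨
      ∃ I' : Finset V, TarReachDel G l b Iini I' ∧ s ≤ I'.card := by
    clear hsI
    induction hI with
    | refl => exact Or.inl ⟨hSI b hb, Relation.ReflTransGen.refl⟩
    | @tail A B _ hstep ih =>
      rcases ih with ⟨hbA, hreach⟩ | hdone
      · by_cases hbB : b ∈ B
        · right
          by_cases hsA : s ≤ A.card
          · exact ⟨A, hreach, hsA⟩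
          have hAB := hstep.subset_of_notMem hbA hbB
          have hcard := card_free_petals hb hbA
            (fun a ha => hstep.2.1 b hbB a (hAB ha)) hsun
          set T := (S.erase b).filter (fun x => ∀ a ∈ A, ¬ (a = x ∨ G.Adj x a)) with hT
          have hTS : ∀ x ∈ T, x ∈ S := fun x hx =>
            Finset.mem_of_mem_erase (Finset.mem_filter.mp hx).1
          have hTA : ∀ x ∈ T, ∀ a ∈ A, ¬ G.Adj x a := fun x hx a ha h =>
            (Finset.mem_filter.mp hx).2 a ha (Or.inr h)
          have hIT : IsIndepSet G (A ∪ T) := by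
            intro u hu v hv huv
            rcases Finset.mem_union.mp hu with hu | hu <;>
              rcases Finset.mem_union.mp hv with hv | hv
            · exact hstep.1 u hu v hv huv
            · exact hTA v hv u hu huv.symm
            · exact hTA u hu v hv huv
            · exact hSindep u (hTS u hu) v (hTS v hv) huv
          have hbT : b ∉ A ∪ T := by simp [hT, hbA]
          refine ⟨A ∪ T, hreach.trans (tarReachDel_union hstep.2.2.1 hIT hbT), ?_⟩
          have := Finset.card_le_card (Finset.subset_union_right : T ⊆ A ∪ T)
          omega
        · exact Or.inl ⟨hbB, hreach.tail ⟨hbA, hbB, hstep⟩⟩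
      · exact Or.inr hdone
  rcases hmain with ⟨-, h⟩ | h
  · exact ⟨I, h, hsI⟩
  · exact h
end
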